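/- Let W, W' ∈ ℝ^{m×n}, let A, B ∈ ℝ^{n×l} with BBᵀ invertible, and let L_B ∈ ℝ^{n×n} be an invertible matrix with BBᵀ = L_B L_Bᵀ. Then ‖W A − W' B‖_F² = ‖W' L_B − W A Bᵀ L_B^{-ᵀ}‖_F² − ‖W A Bᵀ L_B^{-ᵀ}‖_F² + ‖W A‖_F², where L_B^{-ᵀ} denotes the transpose of the inverse of L_B. -/

import Mathlib

open Matrix

noncomputable section

/-- The squared Frobenius norm of a real matrix. -/
def frobSq {m n : ℕ} (M : Matrix (Fin m) (Fin n) ℝ) : ℝ := ∑ i, ∑ j, (M i j) ^ 2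

theorem frobSq_eq_trace {m n : ℕ} (M : Matrix (Fin m) (Fin n) ℝ) :
    frobSq M = (M * Mᵀ).trace := by
  simp [frobSq, Matrix.trace, Matrix.mul_apply, sq]

theorem frobSq_sub {m n : ℕ} (X Y : Matrix (Fin m) (Fin n) ℝ) :
    frobSq (X - Y) = frobSq X - 2 * (X * Yᵀ).trace + frobSq Y := by
  have h : (Y * Xᵀ).trace = (X * Yᵀ).trace := by
    rw [← Matrix.trace_transpose, Matrix.transpose_mul, Matrix.transpose_transpose]
  simp only [frobSq_eq_trace, Matrix.transpose_sub, Matrix.sub_mul, Matrix.mul_sub,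
    Matrix.trace_sub, h]
  ring

/-- Completing the square: with `B Bᵀ` invertible and `B Bᵀ = L Lᵀ` for invertible `L`,
`‖W A − W' B‖_F² = ‖W' L − W A Bᵀ L⁻ᵀ‖_F² − ‖W A Bᵀ L⁻ᵀ‖_F² + ‖W A‖_F²`. -/
theorem frobSq_complete_square {m n l : ℕ}
    (W W' : Matrix (Fin m) (Fin n) ℝ) (A B : Matrix (Fin n) (Fin l) ℝ)
    (hBB : IsUnit (B * Bᵀ).det)
    (L : Matrix (Fin n) (Fin n) ℝ) (hL : IsUnit L.det) (hfac : B * Bᵀ = L * Lᵀ) :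
    frobSq (W * A - W' * B) =
      frobSq (W' * L - W * A * Bᵀ * (L⁻¹)ᵀ) - frobSq (W * A * Bᵀ * (L⁻¹)ᵀ) +
        frobSq (W * A) := by
  have hsq : frobSq (W' * B) = frobSq (W' * L) := by
    have h : W' * B * (W' * B)ᵀ = W' * L * (W' * L)ᵀ := by
      rw [Matrix.transpose_mul, Matrix.transpose_mul, Matrix.mul_assoc, Matrix.mul_assoc,
        ← Matrix.mul_assoc B, ← Matrix.mul_assoc L, hfac]
    rw [frobSq_eq_trace, frobSq_eq_trace, h]
  have hcross : (W' * L * (W * A * Bᵀ * (L⁻¹)ᵀ)ᵀ).trace = (W * A * (W' * B)ᵀ).trace := by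
    have h : W' * L * (W * A * Bᵀ * (L⁻¹)ᵀ)ᵀ = (W * A * (W' * B)ᵀ)ᵀ := by
      simp only [Matrix.transpose_mul, Matrix.transpose_transpose, Matrix.mul_assoc,
        Matrix.mul_nonsing_inv_cancel_left L _ hL]
    rw [h, Matrix.trace_transpose]
  rw [frobSq_sub, frobSq_sub, hsq, hcross]
  ring
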